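/- arXiv:2509.16821 — 2 statements merged into one kernel-verified Lean document; each statement's English description precedes it below -/
import Mathlib

section
/- Let A be a real n×n matrix, B a real n×m matrix, M a symmetric positive semidefinite n×n matrix, and R a symmetric positive definite m×m matrix, with (A, M) observable. Let K₀ make A − B·K₀ Hurwitz, and define recursively: Pᵢ is the symmetric solution of (A − B·Kᵢ)ᵀ Pᵢ + Pᵢ (A − B·Kᵢ) = −(M + Kᵢᵀ R Kᵢ), and Kᵢ₊₁ = R⁻¹ Bᵀ Pᵢ. If P* is a symmetric positive semidefinite solution of the algebraic Riccati equation Aᵀ P* + P* A + M − P* B R⁻¹ Bᵀ P* = 0, then the sequence is monotone in the Loewner order: P* ≼ Pᵢ₊₁ ≼ Pᵢ for every i ≥ 0. -/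
open Matrix

/-- A real square matrix is Hurwitz if every eigenvalue (over ℂ) has negative real part. -/
def IsHurwitz {n : ℕ} (A : Matrix (Fin n) (Fin n) ℝ) : Prop :=
  ∀ μ ∈ spectrum ℂ (A.map (Complex.ofReal)), μ.re < 0

/-- The pair (A, C) is observable if the only x with C Aᵏ x = 0 for all 0 ≤ k < n is x = 0. -/
def IsObservable {n p : ℕ} (A : Matrix (Fin n) (Fin n) ℝ)
    (C : Matrix (Fin p) (Fin n) ℝ) : Prop :=
  ∀ x : Fin n → ℝ, (∀ k < n, C.mulVec ((A ^ k).mulVec x) = 0) → x = 0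

open Filter Topology

/-- In a complex Banach algebra, the powers of an element whose spectrum lies in the open unit disc
tend to zero. -/
theorem tendsto_pow_zero_of_spectrum_lt_one {𝔸 : Type*} [NormedRing 𝔸] [NormedAlgebra ℂ 𝔸]
    [CompleteSpace 𝔸] (a : 𝔸) (ha : ∀ z ∈ spectrum ℂ a, ‖z‖ < 1) :
    Tendsto (fun k : ℕ => a ^ k) atTop (𝓝 0) := by
  rcases subsingleton_or_nontrivial 𝔸 with h | h
  · simp [Subsingleton.elim _ (0 : 𝔸)]
  have hρ : spectralRadius ℂ a < ((1 : NNReal) : ENNReal) :=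
    spectrum.spectralRadius_lt_of_forall_lt a fun z hz => by
      simpa [← NNReal.coe_lt_coe] using ha z hz
  obtain ⟨r, hr, hr1⟩ := ENNReal.lt_iff_exists_nnreal_btwn.mp hρ
  have hr1' : r < 1 := by exact_mod_cast hr1
  have hev := (spectrum.pow_nnnorm_pow_one_div_tendsto_nhds_spectralRadius a).eventually
    (gt_mem_nhds hr)
  refine squeeze_zero_norm' ?_ (tendsto_pow_atTop_nhds_zero_of_lt_one r.2 hr1')
  filter_upwards [hev, eventually_gt_atTop 0] with k hk hk0
  have hk0' : (0 : ℝ) < k := by exact_mod_cast hk0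
  have h1 : (‖a ^ k‖₊ : ENNReal) < (r : ENNReal) ^ (k : ℝ) := by
    rw [one_div, ENNReal.rpow_inv_lt_iff hk0'] at hk
    exact hk
  rw [ENNReal.rpow_natCast] at h1
  have h2 : ‖a ^ k‖₊ < r ^ k := by exact_mod_cast h1
  exact_mod_cast h2.le

theorem Matrix.mem_spectrum_iff_exists_mulVec {n : ℕ} {F : Matrix (Fin n) (Fin n) ℂ} {z : ℂ} :
    z ∈ spectrum ℂ F ↔ ∃ v ≠ 0, F *ᵥ v = z • v := by
  rw [spectrum.mem_iff, Matrix.isUnit_iff_isUnit_det, isUnit_iff_ne_zero, not_not,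
    ← Matrix.exists_mulVec_eq_zero_iff]
  refine exists_congr fun v => and_congr_right fun _ => ?_
  rw [Matrix.sub_mulVec, sub_eq_zero, Algebra.algebraMap_eq_smul_one, Matrix.smul_mulVec,
    Matrix.one_mulVec, eq_comm]

attribute [local instance] Matrix.linftyOpNormedRing Matrix.linftyOpNormedAlgebra in
/-- The powers of a complex matrix with spectral radius less than one tend to zero. -/
theorem Matrix.tendsto_pow_apply_zero {n : ℕ} (F : Matrix (Fin n) (Fin n) ℂ)
    (hF : ∀ z ∈ spectrum ℂ F, ‖z‖ < 1) (i j : Fin n) :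
    Tendsto (fun k : ℕ => (F ^ k) i j) atTop (𝓝 0) := by
  have h := tendsto_pow_zero_of_spectrum_lt_one F hF
  have hc : Continuous fun G : Matrix (Fin n) (Fin n) ℂ => G i j :=
    LinearMap.continuous_of_finiteDimensional (Matrix.entryLinearMap ℂ ℂ i j)
  exact (hc.tendsto 0).comp h

theorem IsHurwitz.isUnit_one_sub {n : ℕ} {A : Matrix (Fin n) (Fin n) ℝ} (hA : IsHurwitz A) :
    IsUnit (1 - A).det := by
  rw [isUnit_iff_ne_zero]
  intro h
  obtain ⟨v, hv, hv0⟩ := Matrix.exists_mulVec_eq_zero_iff.mpr h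
  rw [Matrix.sub_mulVec, Matrix.one_mulVec, sub_eq_zero] at hv0
  have h1 : (1 : ℂ) ∈ spectrum ℂ (A.map Complex.ofReal) := by
    rw [Matrix.mem_spectrum_iff_exists_mulVec]
    refine ⟨Complex.ofReal ∘ v, fun h => hv ?_, ?_⟩
    · ext i; simpa using congrFun h i
    · ext i
      have := RingHom.map_mulVec Complex.ofRealHom A v i
      rw [← hv0] at this
      rw [one_smul]
      exact this.symm
  exact absurd (hA 1 h1) (by simp)

/-- The Cayley transform of a Hurwitz matrix has its spectrum in the open unit disc. -/
theorem IsHurwitz.norm_lt_one_of_mem_spectrum_cayley {n : ℕ} {A : Matrix (Fin n) (Fin n) ℝ}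
    (hA : IsHurwitz A) {z : ℂ}
    (hz : z ∈ spectrum ℂ (((1 + A) * (1 - A)⁻¹).map Complex.ofReal)) : ‖z‖ < 1 := by
  obtain ⟨v, hv, hFv⟩ := Matrix.mem_spectrum_iff_exists_mulVec.mp hz
  have hmap : ∀ X Y : Matrix (Fin n) (Fin n) ℝ,
      (X * Y).map Complex.ofReal = X.map Complex.ofReal * Y.map Complex.ofReal :=
    fun X Y => Matrix.map_mul (f := Complex.ofRealHom)
  have hone : (1 : Matrix (Fin n) (Fin n) ℝ).map Complex.ofReal = 1 :=
    Matrix.map_one _ Complex.ofReal_zero Complex.ofReal_one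
  set w := ((1 - A)⁻¹.map Complex.ofReal) *ᵥ v with hw
  set C := A.map Complex.ofReal with hC
  have hsub : (1 - A).map Complex.ofReal = 1 - C := by
    rw [Matrix.map_sub _ Complex.ofReal_sub, hone]
  have hadd : (1 + A).map Complex.ofReal = 1 + C := by
    rw [Matrix.map_add _ Complex.ofReal_add, hone]
  have hvw : (1 - C) *ᵥ w = v := by
    rw [hw, ← hsub, Matrix.mulVec_mulVec, ← hmap, Matrix.mul_nonsing_inv _ hA.isUnit_one_sub, hone,
      Matrix.one_mulVec]
  have hw0 : w ≠ 0 := fun h => hv (by rw [← hvw, h, Matrix.mulVec_zero])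
  rw [hmap, ← Matrix.mulVec_mulVec, ← hw, ← hvw, hadd, Matrix.add_mulVec, Matrix.sub_mulVec,
    Matrix.one_mulVec] at hFv
  have key : (z + 1) • (C *ᵥ w) = (z - 1) • w := by
    rw [smul_sub] at hFv
    rw [add_smul, sub_smul, one_smul, one_smul]
    linear_combination (norm := module) hFv
  have hz1 : z + 1 ≠ 0 := by
    intro h
    rw [h, zero_smul, eq_comm, smul_eq_zero, or_iff_left hw0] at key
    have h2 : (2 : ℂ) = 0 := by linear_combination h - key
    norm_num at h2
  have hmem : (z - 1) / (z + 1) ∈ spectrum ℂ C := by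
    rw [Matrix.mem_spectrum_iff_exists_mulVec]
    refine ⟨w, hw0, ?_⟩
    rw [div_eq_inv_mul, mul_smul, ← key, smul_smul, inv_mul_cancel₀ hz1, one_smul]
  have hre := hA _ hmem
  rw [Complex.div_re, ← add_div, div_lt_iff₀ (Complex.normSq_pos.mpr hz1), zero_mul] at hre
  have hsq : ‖z‖ ^ 2 < 1 := by
    rw [← Complex.normSq_eq_norm_sq, Complex.normSq_apply]
    simp only [Complex.sub_re, Complex.add_re, Complex.sub_im, Complex.add_im, Complex.one_re,
      Complex.one_im] at hre
    linarith
  exact (sq_lt_one_iff₀ (norm_nonneg z)).mp hsq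

/-- A symmetric solution of the Lyapunov inequality `AᵀX + XA ≼ 0` with `A` Hurwitz is positive
semidefinite. -/
theorem IsHurwitz.posSemidef_of_lyapunov {n : ℕ} {A X Q : Matrix (Fin n) (Fin n) ℝ}
    (hA : IsHurwitz A) (hX : X.IsSymm) (hQ : Q.PosSemidef) (h : Aᵀ * X + X * A = -Q) :
    X.PosSemidef := by
  set N := (1 - A)⁻¹ with hN
  set F := (1 + A) * N with hF
  have hdet := hA.isUnit_one_sub
  have hN1 : (1 - A) * N = 1 := Matrix.mul_nonsing_inv _ hdet
  have hN2 : Nᵀ * (1 - A)ᵀ = 1 := by rw [← Matrix.transpose_mul, hN1, Matrix.transpose_one]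
  have hstein : X - Fᵀ * X * F = Nᵀ * (Q + Q) * N := by
    have e1 : X = Nᵀ * ((1 - A)ᵀ * X * (1 - A)) * N := by
      calc X = (Nᵀ * (1 - A)ᵀ) * X * ((1 - A) * N) := by rw [hN1, hN2]; simp
        _ = _ := by noncomm_ring
    have e2 : (1 - A)ᵀ * X * (1 - A) - (1 + A)ᵀ * X * (1 + A) = Q + Q := by
      have : Q = -(Aᵀ * X + X * A) := by rw [h, neg_neg]
      rw [this]
      simp only [Matrix.transpose_sub, Matrix.transpose_add, Matrix.transpose_one]
      noncomm_ring
    rw [← e2, Matrix.mul_sub, Matrix.sub_mul, ← e1, hF, Matrix.transpose_mul]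
    simp only [Matrix.mul_assoc]
  have hstep : (X - Fᵀ * X * F).PosSemidef := by
    rw [hstein]
    simpa using (hQ.add hQ).conjTranspose_mul_mul_same N
  have hpow : ∀ k : ℕ, (X - (F ^ k)ᵀ * X * F ^ k).PosSemidef := by
    intro k
    induction k with
    | zero => simpa using Matrix.PosSemidef.zero
    | succ k ih =>
      have h1 := ih.add (hstep.conjTranspose_mul_mul_same (F ^ k))
      rw [Matrix.conjTranspose_eq_transpose_of_trivial] at h1
      convert h1 using 1
      rw [pow_succ', Matrix.transpose_mul]
      noncomm_ring
  have hlim : ∀ i j, Tendsto (fun k : ℕ => (F ^ k) i j) atTop (𝓝 0) := by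
    intro i j
    have h1 := Matrix.tendsto_pow_apply_zero (F.map Complex.ofReal)
      (fun z hz => hA.norm_lt_one_of_mem_spectrum_cayley hz) i j
    have h2 : ∀ k : ℕ, (F.map Complex.ofReal ^ k) i j = (((F ^ k) i j : ℝ) : ℂ) := fun k =>
      congrFun (congrFun (Matrix.map_pow F Complex.ofRealHom k).symm i) j
    simp only [h2] at h1
    exact (Complex.continuous_re.tendsto 0).comp h1
  refine .of_dotProduct_mulVec_nonneg (by simpa [Matrix.IsHermitian] using hX.eq) fun v => ?_
  have hlimM : Tendsto (fun k : ℕ => F ^ k) atTop (𝓝 (0 : Matrix (Fin n) (Fin n) ℝ)) :=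
    tendsto_pi_nhds.mpr fun i => tendsto_pi_nhds.mpr fun j => hlim i j
  have hcont : Continuous fun G : Matrix (Fin n) (Fin n) ℝ =>
      star v ⬝ᵥ ((X - Gᵀ * X * G) *ᵥ v) := by fun_prop
  have := (hcont.tendsto 0).comp hlimM
  simp only [Matrix.mul_zero, sub_zero] at this
  exact ge_of_tendsto' this fun k => (hpow k).dotProduct_mulVec_nonneg v

/-- A positive semidefinite solution of a Lyapunov equation whose right-hand side only vanishes on
an unobservable subspace certifies that the matrix is Hurwitz. -/
theorem IsHurwitz.of_lyapunov {n : ℕ} {A X Q : Matrix (Fin n) (Fin n) ℝ}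
    (hX : X.PosSemidef) (hQ : Q.PosSemidef) (h : Aᵀ * X + X * A = -Q)
    (hobs : ∀ (a b : ℝ) (x y : Fin n → ℝ), Q *ᵥ x = 0 → Q *ᵥ y = 0 →
      A *ᵥ x = a • x - b • y → A *ᵥ y = a • y + b • x → x = 0 ∧ y = 0) :
    IsHurwitz A := by
  intro μ hμ
  by_contra! hre
  obtain ⟨w, hw, hAw⟩ := Matrix.mem_spectrum_iff_exists_mulVec.mp hμ
  set x : Fin n → ℝ := fun i => (w i).re with hx
  set y : Fin n → ℝ := fun i => (w i).im with hy
  have hAx : A *ᵥ x = μ.re • x - μ.im • y := by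
    ext i
    simpa [Matrix.mulVec, dotProduct, hx, hy] using congrArg Complex.re (congrFun hAw i)
  have hAy : A *ᵥ y = μ.re • y + μ.im • x := by
    ext i
    simpa [Matrix.mulVec, dotProduct, hx, hy] using congrArg Complex.im (congrFun hAw i)
  have hquad : ∀ v, v ⬝ᵥ (Q *ᵥ v) = -(2 * (v ⬝ᵥ (X *ᵥ (A *ᵥ v)))) := by
    intro v
    have hsymm : Xᵀ = X := by simpa using hX.isHermitian.eq
    have : Q = -(Aᵀ * X + X * A) := by rw [h, neg_neg]
    rw [this, Matrix.neg_mulVec, dotProduct_neg, Matrix.add_mulVec, dotProduct_add,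
      ← Matrix.mulVec_mulVec, ← Matrix.mulVec_mulVec, Matrix.mulVec_transpose,
      dotProduct_comm v, ← Matrix.dotProduct_mulVec, Matrix.dotProduct_mulVec v X,
      ← Matrix.mulVec_transpose, hsymm]
    ring
  have hxy : y ⬝ᵥ (X *ᵥ x) = x ⬝ᵥ (X *ᵥ y) := by
    have hsymm : Xᵀ = X := by simpa using hX.isHermitian.eq
    rw [Matrix.dotProduct_mulVec, ← Matrix.mulVec_transpose, hsymm, dotProduct_comm]
  have hsum : x ⬝ᵥ (Q *ᵥ x) + y ⬝ᵥ (Q *ᵥ y)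
      = -(2 * μ.re * (x ⬝ᵥ (X *ᵥ x) + y ⬝ᵥ (X *ᵥ y))) := by
    rw [hquad, hquad, hAx, hAy, Matrix.mulVec_sub, Matrix.mulVec_add]
    simp only [Matrix.mulVec_smul, dotProduct_sub, dotProduct_add, dotProduct_smul, smul_eq_mul,
      hxy]
    ring
  have hX0 : ∀ v, 0 ≤ v ⬝ᵥ (X *ᵥ v) := fun v => by simpa using hX.dotProduct_mulVec_nonneg v
  have hQ0 : ∀ v, 0 ≤ v ⬝ᵥ (Q *ᵥ v) := fun v => by simpa using hQ.dotProduct_mulVec_nonneg v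
  have hle : x ⬝ᵥ (Q *ᵥ x) + y ⬝ᵥ (Q *ᵥ y) ≤ 0 := by
    rw [hsum]
    exact neg_nonpos.mpr (mul_nonneg (by linarith) (add_nonneg (hX0 x) (hX0 y)))
  have hker : ∀ v, v ⬝ᵥ (Q *ᵥ v) = 0 → Q *ᵥ v = 0 := fun v hv =>
    (hQ.dotProduct_mulVec_zero_iff v).mp (by simpa using hv)
  obtain ⟨h1, h2⟩ := hobs μ.re μ.im x y (hker x (by linarith [hQ0 x, hQ0 y]))
    (hker y (by linarith [hQ0 x, hQ0 y])) hAx hAy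
  exact hw (funext fun i => Complex.ext (congrFun h1 i) (congrFun h2 i))

theorem IsObservable.eq_zero_of_invariant {n p : ℕ} {A : Matrix (Fin n) (Fin n) ℝ}
    {C : Matrix (Fin p) (Fin n) ℝ} (hAC : IsObservable A C) {a b : ℝ} {x y : Fin n → ℝ}
    (hx : C *ᵥ x = 0) (hy : C *ᵥ y = 0) (hAx : A *ᵥ x = a • x - b • y)
    (hAy : A *ᵥ y = a • y + b • x) : x = 0 ∧ y = 0 := by
  have h : ∀ k : ℕ, C *ᵥ (A ^ k *ᵥ x) = 0 ∧ C *ᵥ (A ^ k *ᵥ y) = 0 := by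
    intro k
    induction k with
    | zero => simpa using ⟨hx, hy⟩
    | succ k ih =>
      simp [pow_succ, ← Matrix.mulVec_mulVec, hAx, hAy, Matrix.mulVec_sub, Matrix.mulVec_add,
        Matrix.mulVec_smul, ih.1, ih.2]
  exact ⟨hAC x fun k _ => (h k).1, hAC y fun k _ => (h k).2⟩

/-- Completion of squares in the closed-loop Lyapunov operator, for the gain `L = R⁻¹BᵀS`. -/
theorem lyapunov_completion {n m : ℕ} {A S : Matrix (Fin n) (Fin n) ℝ}
    {B : Matrix (Fin n) (Fin m) ℝ} {R : Matrix (Fin m) (Fin m) ℝ} {L : Matrix (Fin m) (Fin n) ℝ}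
    (hR : R.PosDef) (hS : S.IsSymm) (hL : L = R⁻¹ * Bᵀ * S) (K : Matrix (Fin m) (Fin n) ℝ) :
    (A - B * K)ᵀ * S + S * (A - B * K)
      = Aᵀ * S + S * A - Lᵀ * R * L - Kᵀ * R * K + (K - L)ᵀ * R * (K - L) := by
  have hRu : IsUnit R.det := R.isUnit_iff_isUnit_det.mp hR.isUnit
  have hRs : Rᵀ = R := by simpa using hR.isHermitian.eq
  have h1 : Bᵀ * S = R * L := by
    rw [hL, Matrix.mul_assoc, Matrix.mul_nonsing_inv_cancel_left _ _ hRu]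
  have h2 : S * B = Lᵀ * R := by
    have := congrArg Matrix.transpose h1
    rwa [Matrix.transpose_mul, Matrix.transpose_mul, Matrix.transpose_transpose, hS.eq, hRs] at this
  simp only [Matrix.transpose_sub, Matrix.transpose_mul, Matrix.sub_mul, Matrix.mul_sub,
    Matrix.mul_assoc, h1]
  rw [← Matrix.mul_assoc S B K, h2, Matrix.mul_assoc]
  abel

theorem kleinman_monotone {n m : ℕ}
    (A : Matrix (Fin n) (Fin n) ℝ) (B : Matrix (Fin n) (Fin m) ℝ)
    (M : Matrix (Fin n) (Fin n) ℝ) (R : Matrix (Fin m) (Fin m) ℝ)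
    (hM : M.PosSemidef) (hR : R.PosDef)
    (hObs : IsObservable A M)
    (K : ℕ → Matrix (Fin m) (Fin n) ℝ) (P : ℕ → Matrix (Fin n) (Fin n) ℝ)
    (hK0 : IsHurwitz (A - B * K 0))
    (hPsymm : ∀ i, (P i).IsSymm)
    (hLyap : ∀ i, (A - B * K i)ᵀ * P i + P i * (A - B * K i) = -(M + (K i)ᵀ * R * K i))
    (hKupd : ∀ i, K (i + 1) = R⁻¹ * Bᵀ * P i)
    (Pstar : Matrix (Fin n) (Fin n) ℝ) (hPstar : Pstar.PosSemidef)
    (hRiccati : Aᵀ * Pstar + Pstar * A + M - Pstar * B * R⁻¹ * Bᵀ * Pstar = 0) :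
    ∀ i, (P (i + 1) - Pstar).PosSemidef ∧ (P i - P (i + 1)).PosSemidef := by
  have hsq : ∀ L : Matrix (Fin m) (Fin n) ℝ, (Lᵀ * R * L).PosSemidef := fun L => by
    simpa using hR.posSemidef.conjTranspose_mul_mul_same L
  have hcost : ∀ i, (M + (K i)ᵀ * R * K i).PosSemidef := fun i => hM.add (hsq _)
  have hnext : ∀ i, (A - B * K (i + 1))ᵀ * P i + P i * (A - B * K (i + 1))
      = -(M + (K (i + 1))ᵀ * R * K (i + 1) + (K i - K (i + 1))ᵀ * R * (K i - K (i + 1))) := by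
    intro i
    have h1 := hLyap i
    rw [lyapunov_completion hR (hPsymm i) (hKupd i)] at h1 ⊢
    rw [sub_self, Matrix.mul_zero, add_zero]
    linear_combination (norm := noncomm_ring) h1
  have hker : ∀ {l : ℕ} {Q₁ Q₂ : Matrix (Fin l) (Fin l) ℝ} {v : Fin l → ℝ}, Q₁.PosSemidef →
      Q₂.PosSemidef → (Q₁ + Q₂) *ᵥ v = 0 → Q₁ *ᵥ v = 0 ∧ Q₂ *ᵥ v = 0 := by
    intro l Q₁ Q₂ v h1 h2 h
    have h1' := h1.dotProduct_mulVec_nonneg v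
    have h2' := h2.dotProduct_mulVec_nonneg v
    have h0 : star v ⬝ᵥ (Q₁ *ᵥ v) + star v ⬝ᵥ (Q₂ *ᵥ v) = 0 := by
      rw [← dotProduct_add, ← Matrix.add_mulVec, h, dotProduct_zero]
    exact ⟨(h1.dotProduct_mulVec_zero_iff v).mp (by linarith),
      (h2.dotProduct_mulVec_zero_iff v).mp (by linarith)⟩
  have hgain : ∀ {L : Matrix (Fin m) (Fin n) ℝ} {v : Fin n → ℝ},
      (Lᵀ * R * L) *ᵥ v = 0 → L *ᵥ v = 0 := by
    intro L v h
    by_contra hne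
    have h1 := hR.dotProduct_mulVec_pos hne
    have h2 : star (L *ᵥ v) ⬝ᵥ (R *ᵥ (L *ᵥ v)) = v ⬝ᵥ ((Lᵀ * R * L) *ᵥ v) := by
      rw [star_trivial, ← Matrix.mulVec_mulVec, ← Matrix.mulVec_mulVec, Matrix.dotProduct_mulVec v,
        Matrix.vecMul_transpose]
    rw [h2, h, dotProduct_zero] at h1
    exact h1.false
  have hstable : ∀ i, IsHurwitz (A - B * K i) := by
    intro i
    induction i with
    | zero => exact hK0
    | succ i ih =>
      have hP := ih.posSemidef_of_lyapunov (hPsymm i) (hcost i) (hLyap i)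
      refine .of_lyapunov hP ((hcost (i + 1)).add (hsq _)) (hnext i) ?_
      intro a b x y hx hy hAx hAy
      obtain ⟨hMx, hKx⟩ := hker hM (hsq _) (hker (hcost _) (hsq _) hx).1
      obtain ⟨hMy, hKy⟩ := hker hM (hsq _) (hker (hcost _) (hsq _) hy).1
      rw [Matrix.sub_mulVec, ← Matrix.mulVec_mulVec, hgain hKx, Matrix.mulVec_zero, sub_zero] at hAx
      rw [Matrix.sub_mulVec, ← Matrix.mulVec_mulVec, hgain hKy, Matrix.mulVec_zero, sub_zero] at hAy
      exact hObs.eq_zero_of_invariant hMx hMy hAx hAy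
  have hSsymm : Pstar.IsSymm := by
    simpa only [Matrix.IsSymm, Matrix.conjTranspose_eq_transpose_of_trivial] using
      hPstar.isHermitian.eq
  set L := R⁻¹ * Bᵀ * Pstar with hL
  have hRicc : Aᵀ * Pstar + Pstar * A - Lᵀ * R * L = -M := by
    have hRu : IsUnit R.det := R.isUnit_iff_isUnit_det.mp hR.isUnit
    have hRs : Rᵀ = R := by simpa using hR.isHermitian.eq
    have : Lᵀ * R * L = Pstar * B * R⁻¹ * Bᵀ * Pstar := by
      rw [hL]
      simp only [Matrix.transpose_mul, Matrix.transpose_transpose, Matrix.transpose_nonsing_inv,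
        hRs, hSsymm.eq, Matrix.mul_assoc, Matrix.mul_nonsing_inv_cancel_left _ _ hRu]
    rw [this]
    linear_combination (norm := noncomm_ring) hRiccati
  intro i
  constructor
  · refine (hstable (i + 1)).posSemidef_of_lyapunov ((hPsymm _).sub hSsymm) (hsq (K (i + 1) - L)) ?_
    have h1 := lyapunov_completion (A := A) hR hSsymm hL (K (i + 1))
    rw [hRicc] at h1
    rw [Matrix.mul_sub, Matrix.sub_mul]
    linear_combination (norm := noncomm_ring) hLyap (i + 1) - h1
  · refine (hstable (i + 1)).posSemidef_of_lyapunov ((hPsymm _).sub (hPsymm _))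
      (hsq (K i - K (i + 1))) ?_
    rw [Matrix.mul_sub, Matrix.sub_mul]
    linear_combination (norm := noncomm_ring) hnext i - hLyap (i + 1)
end

section
/- Let A ∈ ℝ^{n×n}, B ∈ ℝ^{n×m}, M ∈ ℝ^{n×n} symmetric, R ∈ ℝ^{m×m} symmetric, K ∈ ℝ^{m×n}, and let P ∈ ℝ^{n×n} be a symmetric matrix satisfying (A − B K)ᵀ P + P (A − B K) = −(M + Kᵀ R K). Let x : ℝ → ℝⁿ be differentiable and w : ℝ → ℝᵐ continuous, set u_i(t) = −K x(t) and u(t) = u_i(t) + w(t), and suppose x'(t) = A x(t) + B u(t) on [t₀, t₁]. Then x(t₀)ᵀ P x(t₀) + 2 ∫_{t₀}^{t₁} x(τ)ᵀ P B w(τ) dτ + ∫_{t₀}^{t₁} w(τ)ᵀ R w(τ) dτ + 2 ∫_{t₀}^{t₁} u_i(τ)ᵀ R w(τ) dτ = ∫_{t₀}^{t₁} ( x(τ)ᵀ M x(τ) + u(τ)ᵀ R u(τ) ) dτ + x(t₁)ᵀ P x(t₁). -/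
open Matrix intervalIntegral

theorem Matrix.IsSymm.dotProduct_mulVec_comm {ι α : Type*} [Fintype ι] [CommSemiring α]
    {S : Matrix ι ι α} (hS : S.IsSymm) (a b : ι → α) :
    a ⬝ᵥ S *ᵥ b = b ⬝ᵥ S *ᵥ a := by
  rw [dotProduct_mulVec, ← mulVec_transpose, hS.eq, dotProduct_comm]

theorem HasDerivAt.dotProduct {ι : Type*} [Fintype ι] {f g : ℝ → ι → ℝ} {f' g' : ι → ℝ} {t : ℝ}
    (hf : HasDerivAt f f' t) (hg : HasDerivAt g g' t) :
    HasDerivAt (fun s => f s ⬝ᵥ g s) (f' ⬝ᵥ g t + f t ⬝ᵥ g') t := by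
  simp only [_root_.dotProduct, ← Finset.sum_add_distrib]
  exact HasDerivAt.fun_sum fun i _ => (hasDerivAt_pi.1 hf i).mul (hasDerivAt_pi.1 hg i)

theorem HasDerivAt.matrix_mulVec {ι κ : Type*} [Fintype ι] [Fintype κ] (S : Matrix κ ι ℝ)
    {f : ℝ → ι → ℝ} {f' : ι → ℝ} {t : ℝ} (hf : HasDerivAt f f' t) :
    HasDerivAt (fun s => S *ᵥ f s) (S *ᵥ f') t :=
  (LinearMap.toContinuousLinearMap S.mulVecLin).hasFDerivAt.comp_hasDerivAt t hf

/-- The quadratic form of `P` differentiated along a closed-loop direction perturbed by `w`. -/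
theorem lyapunov_quadratic_form_derivative {ι κ : Type*} [Fintype ι] [Fintype κ]
    {A M P : Matrix ι ι ℝ} {B : Matrix ι κ ℝ} {R : Matrix κ κ ℝ} {K : Matrix κ ι ℝ}
    (hP : P.IsSymm)
    (hLyap : (A - B * K)ᵀ * P + P * (A - B * K) = -(M + Kᵀ * R * K)) (y : ι → ℝ) (w : κ → ℝ) :
    2 * (y ⬝ᵥ P *ᵥ (A *ᵥ y + B *ᵥ (-(K *ᵥ y) + w))) =
      2 * (y ⬝ᵥ (P * B) *ᵥ w) - y ⬝ᵥ M *ᵥ y - (K *ᵥ y) ⬝ᵥ R *ᵥ (K *ᵥ y) := by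
  have hdir : A *ᵥ y + B *ᵥ (-(K *ᵥ y) + w) = (A - B * K) *ᵥ y + B *ᵥ w := by
    rw [mulVec_add, mulVec_neg, sub_mulVec, mulVec_mulVec]
    abel
  have hform := congrArg (fun S => y ⬝ᵥ S *ᵥ y) hLyap
  simp only [add_mulVec, neg_mulVec, dotProduct_add, dotProduct_neg, Matrix.mul_assoc] at hform
  simp only [← mulVec_mulVec] at hform
  rw [dotProduct_mulVec y (A - B * K)ᵀ, dotProduct_mulVec y Kᵀ, vecMul_transpose,
    vecMul_transpose, hP.dotProduct_mulVec_comm] at hform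
  rw [hdir, mulVec_add, dotProduct_add, ← mulVec_mulVec]
  linarith

theorem exploration_noise_integral_identity {n m : ℕ}
    (A : Matrix (Fin n) (Fin n) ℝ) (B : Matrix (Fin n) (Fin m) ℝ)
    (M : Matrix (Fin n) (Fin n) ℝ) (R : Matrix (Fin m) (Fin m) ℝ)
    (hM : M.IsSymm) (hR : R.IsSymm)
    (K : Matrix (Fin m) (Fin n) ℝ)
    (P : Matrix (Fin n) (Fin n) ℝ) (hPsymm : P.IsSymm)
    (hLyap : (A - B * K)ᵀ * P + P * (A - B * K) = -(M + Kᵀ * R * K))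
    (x : ℝ → Fin n → ℝ) (w : ℝ → Fin m → ℝ)
    (hx : Differentiable ℝ x) (hw : Continuous w)
    (uᵢ u : ℝ → Fin m → ℝ)
    (huᵢ : ∀ t, uᵢ t = -K.mulVec (x t)) (hu : ∀ t, u t = uᵢ t + w t)
    (t₀ t₁ : ℝ) (ht : t₀ ≤ t₁)
    (hode : ∀ t ∈ Set.Icc t₀ t₁, deriv x t = A.mulVec (x t) + B.mulVec (u t)) :
    x t₀ ⬝ᵥ P.mulVec (x t₀) +
        2 * (∫ τ in t₀..t₁, x τ ⬝ᵥ (P * B).mulVec (w τ)) +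
        (∫ τ in t₀..t₁, w τ ⬝ᵥ R.mulVec (w τ)) +
        2 * (∫ τ in t₀..t₁, uᵢ τ ⬝ᵥ R.mulVec (w τ)) =
      (∫ τ in t₀..t₁, (x τ ⬝ᵥ M.mulVec (x τ) + u τ ⬝ᵥ R.mulVec (u τ))) +
        x t₁ ⬝ᵥ P.mulVec (x t₁) := by
  have hxc : Continuous x := hx.continuous
  have huᵢc : Continuous uᵢ := by
    rw [funext huᵢ]
    exact (continuous_const.matrix_mulVec hxc).neg
  have huc : Continuous u := by
    rw [funext hu]
    exact huᵢc.add hw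
  have hform : ∀ {k l : ℕ} (S : Matrix (Fin k) (Fin l) ℝ) {f : ℝ → Fin k → ℝ} {g : ℝ → Fin l → ℝ},
      Continuous f → Continuous g →
        IntervalIntegrable (fun τ => f τ ⬝ᵥ S.mulVec (g τ)) MeasureTheory.volume t₀ t₁ :=
    fun S _ _ hf hg =>
      (hf.dotProduct (continuous_const.matrix_mulVec hg)).intervalIntegrable _ _
  have hxPBw := (hform (P * B) hxc hw).const_mul 2
  have hwRw := hform R hw hw
  have huᵢRw := (hform R huᵢc hw).const_mul 2
  have hreward := (hform M hxc hxc).add (hform R huc huc)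
  have hftc := integral_eq_sub_of_hasDerivAt (a := t₀) (b := t₁)
    (f := fun τ => x τ ⬝ᵥ P.mulVec (x τ))
    (f' := fun τ => 2 * (x τ ⬝ᵥ (P * B).mulVec (w τ)) + w τ ⬝ᵥ R.mulVec (w τ) +
      2 * (uᵢ τ ⬝ᵥ R.mulVec (w τ)) - (x τ ⬝ᵥ M.mulVec (x τ) + u τ ⬝ᵥ R.mulVec (u τ)))
    (fun t hmem => by
      rw [Set.uIcc_of_le ht] at hmem
      have hderiv := (hx t).hasDerivAt
      refine (hderiv.dotProduct (hderiv.matrix_mulVec P)).congr_deriv ?_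
      have hLyapDeriv := lyapunov_quadratic_form_derivative hPsymm hLyap (x t) (w t)
      rw [hPsymm.dotProduct_mulVec_comm (deriv x t), ← two_mul, hode t hmem, hu, huᵢ, hLyapDeriv]
      simp only [mulVec_add, mulVec_neg, dotProduct_add, add_dotProduct, neg_dotProduct,
        dotProduct_neg]
      rw [hR.dotProduct_mulVec_comm (w t) (K.mulVec (x t))]
      ring)
    (((hxPBw.add hwRw).add huᵢRw).sub hreward)
  rw [integral_sub ((hxPBw.add hwRw).add huᵢRw) hreward, integral_add (hxPBw.add hwRw) huᵢRw,
    integral_add hxPBw hwRw, integral_const_mul, integral_const_mul] at hftc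
  linarith
end
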